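/- Let G ⊂ GL(n, ℂ) be a finite subgroup acting linearly on the polynomial ring ℂ[x_1, …, x_n] (each g ∈ G acts by the linear change of variables determined by the matrix g). For each m ≥ 1, let ℂ[x_1,…,x_n]^G_{<m} denote the complex vector space of G-invariant polynomials of total degree strictly less than m. Then the limit lim_{m→∞} (n! · dim_ℂ ℂ[x_1,…,x_n]^G_{<m}) / m^n exists and equals 1/|G|. -/

import Mathlib

open MvPolynomial Filter

/-- The action of an invertible matrix `g ∈ GL(n, ℂ)` on the polynomial ring
`ℂ[x_1, …, x_n]`, i.e. the `ℂ`-algebra automorphism induced by the linear action of `g`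
on the standard representation `ℂ^n`: it sends the variable `x_i` to `∑ j, g_{j i} x_j`. -/
noncomputable def glAct {n : ℕ} (g : GL (Fin n) ℂ) :
    MvPolynomial (Fin n) ℂ →ₐ[ℂ] MvPolynomial (Fin n) ℂ :=
  MvPolynomial.aeval fun i : Fin n =>
    ∑ j : Fin n, ((g : Matrix (Fin n) (Fin n) ℂ) j i) • MvPolynomial.X j

/-- `ℂ[x_1, …, x_n]^G_{≤ m}`: the subspace of `G`-invariant polynomials of total degree
at most `m`. -/
noncomputable def invariantsLE {n : ℕ} (G : Subgroup (GL (Fin n) ℂ)) (m : ℕ) :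
    Submodule ℂ (MvPolynomial (Fin n) ℂ) :=
  (⨅ g ∈ G, LinearMap.eqLocus (glAct g).toLinearMap LinearMap.id) ⊓
    MvPolynomial.restrictTotalDegree (Fin n) ℂ m

theorem glAct_X {n : ℕ} (g : GL (Fin n) ℂ) (i : Fin n) :
    glAct g (X i) = ∑ j : Fin n, ((g : Matrix (Fin n) (Fin n) ℂ) j i) • X j := by
  simp [glAct]

theorem glAct_mul_apply {n : ℕ} (g h : GL (Fin n) ℂ) (p : MvPolynomial (Fin n) ℂ) :
    glAct (g * h) p = glAct g (glAct h p) := by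
  suffices glAct (g * h) = (glAct g).comp (glAct h) from DFunLike.congr_fun this p
  refine MvPolynomial.algHom_ext fun i => ?_
  simp only [AlgHom.comp_apply, glAct_X, map_sum, map_smul, Units.val_mul, Matrix.mul_apply,
    Finset.sum_smul, Finset.smul_sum, smul_smul]
  rw [Finset.sum_comm]
  simp only [mul_comm]

theorem glAct_one_apply {n : ℕ} (p : MvPolynomial (Fin n) ℂ) : glAct 1 p = p := by
  suffices glAct (1 : GL (Fin n) ℂ) = AlgHom.id ℂ _ from DFunLike.congr_fun this p
  refine MvPolynomial.algHom_ext fun i => ?_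
  simp [glAct_X, Matrix.one_apply, ite_smul]

theorem glAct_injective {n : ℕ} (g : GL (Fin n) ℂ) : Function.Injective (glAct g) := by
  refine Function.LeftInverse.injective (g := glAct g⁻¹) fun p => ?_
  rw [← glAct_mul_apply, inv_mul_cancel, glAct_one_apply]

/-- The action of `GL(n, ℂ)` on polynomials is faithful. -/
theorem eq_one_of_glAct_eq_id {n : ℕ} {g : GL (Fin n) ℂ} (h : ∀ p, glAct g p = p) : g = 1 := by
  ext j i
  have hc := congrArg (coeff (Finsupp.single j 1)) (h (X i))
  rw [glAct_X] at hc
  simp only [coeff_sum, coeff_smul, coeff_X, smul_eq_mul, mul_ite, mul_one, mul_zero,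
    Finsupp.single_left_inj one_ne_zero, Finset.sum_ite_eq', Finset.mem_univ, if_true] at hc
  rw [hc, Units.val_one, Matrix.one_apply]
  simp only [eq_comm]

theorem totalDegree_glAct_le {n : ℕ} (g : GL (Fin n) ℂ) (p : MvPolynomial (Fin n) ℂ) :
    (glAct g p).totalDegree ≤ p.totalDegree := by
  rw [glAct, aeval_def, eval₂_eq']
  refine totalDegree_finsetSum_le fun d hd => ?_
  refine (totalDegree_mul _ _).trans ?_
  rw [algebraMap_eq, totalDegree_C, zero_add]
  refine (totalDegree_finsetProd _ _).trans (le_trans ?_ (le_totalDegree hd))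
  rw [Finsupp.sum_fintype _ _ fun _ => rfl]
  refine Finset.sum_le_sum fun i _ => (totalDegree_pow _ _).trans ?_
  refine (Nat.mul_le_mul_left _ (totalDegree_finsetSum_le (d := 1) fun j _ => ?_)).trans
    (mul_one _).le
  exact (totalDegree_smul_le _ _).trans (totalDegree_X j).le

theorem mem_invariantsLE {n : ℕ} {G : Subgroup (GL (Fin n) ℂ)} {m : ℕ}
    {p : MvPolynomial (Fin n) ℂ} :
    p ∈ invariantsLE G m ↔ (∀ g ∈ G, glAct g p = p) ∧ p.totalDegree ≤ m := by
  simp [invariantsLE, mem_restrictTotalDegree]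

instance {n : ℕ} (G : Subgroup (GL (Fin n) ℂ)) (m : ℕ) : Module.Finite ℂ (invariantsLE G m) :=
  Submodule.finiteDimensional_of_le (S₂ := restrictTotalDegree (Fin n) ℂ m) inf_le_right

/-- Some polynomial has `|G|` distinct images under a finite subgroup `G ⊂ GL(n, ℂ)`. -/
theorem exists_injective_glAct {n : ℕ} (G : Subgroup (GL (Fin n) ℂ)) [Finite G] :
    ∃ p : MvPolynomial (Fin n) ℂ, Function.Injective fun g : G => glAct (g : GL (Fin n) ℂ) p := by
  by_contra! hG
  let F : {g : G // g ≠ 1} → Submodule ℂ (MvPolynomial (Fin n) ℂ) := fun g =>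
    LinearMap.eqLocus (glAct (g.1 : GL (Fin n) ℂ)).toLinearMap LinearMap.id
  have hcover : ⋃ g, (F g : Set (MvPolynomial (Fin n) ℂ)) = Set.univ := by
    refine Set.eq_univ_of_forall fun p => ?_
    obtain ⟨g, h, hgh, hne⟩ := Function.not_injective_iff.1 (hG p)
    have hgh : glAct (g : GL (Fin n) ℂ) p = glAct (h : GL (Fin n) ℂ) p := hgh
    refine Set.mem_iUnion.2 ⟨⟨h⁻¹ * g, fun h1 => hne (inv_mul_eq_one.1 h1).symm⟩, ?_⟩
    change glAct ((h : GL (Fin n) ℂ)⁻¹ * (g : GL (Fin n) ℂ)) p = p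
    rw [glAct_mul_apply, hgh, ← glAct_mul_apply, inv_mul_cancel, glAct_one_apply]
  obtain ⟨⟨g, hg⟩, htop⟩ := Subspace.exists_eq_top_of_iUnion_eq_univ hcover
  refine hg (Subtype.ext (eq_one_of_glAct_eq_id fun p => ?_))
  exact (htop ▸ Submodule.mem_top : p ∈ F ⟨g, hg⟩)

theorem totalDegree_mul_pow_le {σ R : Type*} [CommSemiring R] {N m : ℕ} {p r : MvPolynomial σ R}
    (hr : r.totalDegree ≤ m) (i : Fin N) :
    (r * p ^ (i : ℕ)).totalDegree ≤ m + N * p.totalDegree := by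
  refine (totalDegree_mul _ _).trans (add_le_add hr ((totalDegree_pow _ _).trans ?_))
  exact Nat.mul_le_mul_right _ i.2.le

/-- The powers `p ^ i`, `i < |G|`, are linearly independent over the invariants when `p` has
trivial stabilizer. -/
theorem card_mul_finrank_invariantsLE_le {n : ℕ} (G : Subgroup (GL (Fin n) ℂ)) [Finite G]
    {p : MvPolynomial (Fin n) ℂ} (hp : Function.Injective fun g : G => glAct (g : GL (Fin n) ℂ) p)
    (m : ℕ) :
    Nat.card G * Module.finrank ℂ (invariantsLE G m) ≤
      Module.finrank ℂ (restrictTotalDegree (Fin n) ℂ (m + Nat.card G * p.totalDegree)) := by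
  let e := Finite.equivFin G
  let L : (Fin (Nat.card G) → invariantsLE G m) →ₗ[ℂ]
      restrictTotalDegree (Fin n) ℂ (m + Nat.card G * p.totalDegree) :=
    LinearMap.codRestrict _
      (∑ i : Fin (Nat.card G), LinearMap.mulRight ℂ (p ^ (i : ℕ)) ∘ₗ (invariantsLE G m).subtype ∘ₗ LinearMap.proj i)
      fun a => by
        rw [mem_restrictTotalDegree, LinearMap.sum_apply]
        exact totalDegree_finsetSum_le fun i _ =>
          totalDegree_mul_pow_le (mem_invariantsLE.1 (a i).2).2 i
  have hL : Function.Injective L := by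
    refine (injective_iff_map_eq_zero L).2 fun a ha => ?_
    have ha' : ∑ i : Fin (Nat.card G), (a i : MvPolynomial (Fin n) ℂ) * p ^ (i : ℕ) = 0 := by
      simpa [L] using congrArg Subtype.val ha
    have h0 := Matrix.eq_zero_of_forall_index_sum_mul_pow_eq_zero
      (v := fun i => (a i : MvPolynomial (Fin n) ℂ)) (hp.comp e.symm.injective) fun j => by
        have := congrArg (glAct (e.symm j : GL (Fin n) ℂ)) ha'
        rw [map_sum, map_zero] at this
        rw [← this]
        refine Finset.sum_congr rfl fun i _ => ?_
        rw [map_mul, map_pow, (mem_invariantsLE.1 (a i).2).1 _ (e.symm j).2]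
        rfl
    exact funext fun i => Subtype.ext (congrFun h0 i)
  simpa [Module.finrank_pi_fintype] using LinearMap.finrank_le_finrank_of_injective hL

/-- A polynomial `r` is determined by the traces of `r * p ^ i`, `i < |G|`, when `p` has
trivial stabilizer. -/
theorem finrank_restrictTotalDegree_le_card_mul {n : ℕ} (G : Subgroup (GL (Fin n) ℂ)) [Finite G]
    {p : MvPolynomial (Fin n) ℂ} (hp : Function.Injective fun g : G => glAct (g : GL (Fin n) ℂ) p)
    (m : ℕ) :
    Module.finrank ℂ (restrictTotalDegree (Fin n) ℂ m) ≤
      Nat.card G * Module.finrank ℂ (invariantsLE G (m + Nat.card G * p.totalDegree)) := by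
  have := Fintype.ofFinite G
  let e := Finite.equivFin G
  let L : restrictTotalDegree (Fin n) ℂ m →ₗ[ℂ]
      (Fin (Nat.card G) → invariantsLE G (m + Nat.card G * p.totalDegree)) :=
    LinearMap.pi fun i => LinearMap.codRestrict _
      ((∑ g : G, (glAct (g : GL (Fin n) ℂ)).toLinearMap) ∘ₗ LinearMap.mulRight ℂ (p ^ (i : ℕ)) ∘ₗ
        (restrictTotalDegree (Fin n) ℂ m).subtype)
      fun r => by
        rw [mem_invariantsLE, LinearMap.comp_apply, LinearMap.sum_apply]
        refine ⟨fun h hh => ?_, totalDegree_finsetSum_le fun g _ =>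
          (totalDegree_glAct_le _ _).trans
            (totalDegree_mul_pow_le ((mem_restrictTotalDegree _ _ _).1 r.2) i)⟩
        rw [map_sum]
        refine Fintype.sum_equiv (Equiv.mulLeft (⟨h, hh⟩ : G)) _ _ fun g => ?_
        exact (glAct_mul_apply _ _ _).symm
  have hL : Function.Injective L := by
    refine (injective_iff_map_eq_zero L).2 fun r hr => ?_
    have hr' (i : Fin (Nat.card G)) :
        ∑ g : G, glAct (g : GL (Fin n) ℂ) (r * p ^ (i : ℕ)) = 0 := by
      simpa [L] using congrArg Subtype.val (congrFun hr i)
    have h0 := Matrix.eq_zero_of_forall_pow_sum_mul_pow_eq_zero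
      (v := fun j => glAct (e.symm j : GL (Fin n) ℂ) (r : MvPolynomial (Fin n) ℂ))
      (hp.comp e.symm.injective) fun i => by
        rw [← hr' i]
        refine Fintype.sum_equiv e.symm _ _ fun j => ?_
        rw [map_mul, map_pow]
        rfl
    refine Subtype.ext (glAct_injective (e.symm (e 1) : GL (Fin n) ℂ) ?_)
    rw [ZeroMemClass.coe_zero, map_zero]
    exact congrFun h0 (e 1)
  simpa [Module.finrank_pi_fintype] using LinearMap.finrank_le_finrank_of_injective hL

theorem finrank_restrictTotalDegree (K : Type*) [Field K] (n m : ℕ) :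
    Module.finrank K (restrictTotalDegree (Fin n) K m) = (m + n).choose n := by
  classical
  have hs : {d : Fin n →₀ ℕ | (d.sum fun _ e => e) ≤ m} =
      ((Finset.range (m + 1)).biUnion fun k => Finset.univ.finsuppAntidiag k :
        Finset (Fin n →₀ ℕ)) := by
    ext d
    simp [Finset.mem_finsuppAntidiag, Finsupp.sum_fintype]
  rw [restrictTotalDegree, Module.finrank_eq_nat_card_basis (basisRestrictSupport K _), hs,
    Nat.card_coe_set_eq, Set.ncard_coe_finset, Finset.card_biUnion]
  · simp [Finset.card_finsuppAntidiag_nat_eq_multichoose, Nat.sum_range_multichoose]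
  · intro i _ j _ hij
    refine Finset.disjoint_left.2 fun d hi hj => hij ?_
    rw [Finset.mem_finsuppAntidiag] at hi hj
    exact hi.1.symm.trans hj.1

theorem succ_pow_le_factorial_mul_choose (m n : ℕ) :
    (m + 1) ^ n ≤ n.factorial * (m + n).choose n := by
  rw [← Nat.ascFactorial_eq_factorial_mul_choose]
  exact Nat.pow_succ_le_ascFactorial _ _

theorem factorial_mul_choose_le_pow (m n : ℕ) :
    n.factorial * (m + n).choose n ≤ (m + n) ^ n := by
  rw [← Nat.ascFactorial_eq_factorial_mul_choose]
  exact Nat.ascFactorial_le_pow_add _ _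

theorem tendsto_inv_mul_add_div_pow (N c : ℝ) (n : ℕ) :
    Tendsto (fun m : ℕ => N⁻¹ * (((m : ℝ) + c) / m) ^ n) atTop (nhds (1 / N)) := by
  have h : Tendsto (fun m : ℕ => N⁻¹ * (1 + c / (m : ℝ)) ^ n) atTop
      (nhds (N⁻¹ * (1 + 0) ^ n)) :=
    (((tendsto_const_div_atTop_nhds_zero_nat c).const_add 1).pow n).const_mul _
  rw [add_zero, one_pow, mul_one, ← one_div] at h
  refine h.congr' ?_
  filter_upwards [eventually_gt_atTop 0] with m hm
  have : (m : ℝ) ≠ 0 := by positivity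
  rw [add_div, div_self this, one_div]

/-- Let `G ⊂ GL(n, ℂ)` be a finite subgroup acting linearly on `ℂ[x_1, …, x_n]`.
Then `lim_{m→∞} (n! · dim_ℂ ℂ[x_1,…,x_n]^G_{<m}) / m^n = 1/|G|`
(here the invariants of degree `< m` are the invariants of degree `≤ m - 1`). -/
theorem tendsto_finrank_invariants_div_pow
    (n : ℕ) (hn : 1 ≤ n) (G : Subgroup (GL (Fin n) ℂ)) [Finite G] :
    Filter.Tendsto
      (fun m : ℕ =>
        ((n.factorial : ℝ) * (Module.finrank ℂ ↥(invariantsLE G (m - 1)) : ℝ)) / (m : ℝ) ^ n)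
      Filter.atTop (nhds (1 / (Nat.card G : ℝ))) := by
  obtain ⟨p, hp⟩ := exists_injective_glAct G
  have hN : (0 : ℝ) < Nat.card G := by exact_mod_cast Nat.card_pos
  set N := Nat.card G
  set c := N * p.totalDegree
  refine tendsto_of_tendsto_of_tendsto_of_le_of_le' (tendsto_inv_mul_add_div_pow N (-c) n)
    (tendsto_inv_mul_add_div_pow N (c + n) n) ?_ ?_
  · filter_upwards [eventually_gt_atTop c] with m hm
    obtain ⟨k, rfl⟩ := Nat.exists_eq_add_of_lt hm
    have h1 := finrank_restrictTotalDegree_le_card_mul G hp k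
    rw [finrank_restrictTotalDegree] at h1
    have h2 := (succ_pow_le_factorial_mul_choose k n).trans (Nat.mul_le_mul_left _ h1)
    have h3 : c + k + 1 - 1 = k + c := by omega
    have h4 : ((k : ℝ) + 1) ^ n ≤ n.factorial * (N * Module.finrank ℂ (invariantsLE G (k + c))) := by
      exact_mod_cast h2
    have h5 : ((c + k + 1 : ℕ) : ℝ) + -c = k + 1 := by push_cast; ring
    rw [h3, h5, div_pow, ← mul_div_assoc]
    refine div_le_div_of_nonneg_right ?_ (by positivity)
    rw [inv_mul_le_iff₀ hN]
    linarith
  · filter_upwards [eventually_gt_atTop 0] with m hm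
    have h1 := card_mul_finrank_invariantsLE_le G hp (m - 1)
    rw [finrank_restrictTotalDegree] at h1
    have h2 := ((Nat.mul_le_mul_left _ h1).trans (factorial_mul_choose_le_pow _ n)).trans
      (Nat.pow_le_pow_left (show m - 1 + c + n ≤ m + (c + n) by omega) n)
    have h4 : (n.factorial : ℝ) * (N * Module.finrank ℂ (invariantsLE G (m - 1))) ≤
        ((m : ℝ) + (c + n)) ^ n := by
      exact_mod_cast h2
    rw [div_pow, ← mul_div_assoc]
    refine div_le_div_of_nonneg_right ?_ (by positivity)
    rw [le_inv_mul_iff₀ hN]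
    linarith
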